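/- arXiv:2502.12395 — 4 statements merged into one kernel-verified Lean document; each statement's English description precedes it below -/
import Mathlib

section
/- Let T > 0, d ∈ ℕ, and let K be a compact subset of the path space C([0,T]; ℝ^d) equipped with the uniform norm ‖ω‖_∞ := sup_{t∈[0,T]} ‖ω(t)‖₁. Then for every continuous functional F : K → ℝ and every ε > 0 there exist n ∈ ℕ, times 0 ≤ t₁ < t₂ < … < tₙ ≤ T, a constant b > 0, and a function f : (ℝ^d)ⁿ → ℝ satisfying the n-averaged Lipschitz condition with constant b, such that sup_{ω∈K} |F(ω) − f(ω(t₁), …, ω(tₙ))| < ε. In other words, the algebra of regularized (averaged-Lipschitz) cylinder functionals is uniformly dense in C(K). -/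
/-- `f : (ℝ^d)ⁿ → ℝ` satisfies the `n`-averaged Lipschitz condition with constant `b`
(with respect to the ℓ¹ norm on ℝ^d). -/
def AvgLip {d n : ℕ} (b : ℝ) (f : (Fin n → (Fin d → ℝ)) → ℝ) : Prop :=
  ∀ x y : Fin n → (Fin d → ℝ),
    |f x - f y| ≤ (b / n) * ∑ i, ∑ j, |x i j - y i j|

/-- The pairs on which a continuous function on a compact space of paths varies by at least `η`
are separated, uniformly, by finitely many evaluations. -/
theorem exists_finset_separating {α X : Type*} {d : ℕ} [TopologicalSpace α]
    [TopologicalSpace X] [CompactSpace X] (e : X → C(α, Fin d → ℝ)) (he : Continuous e)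
    (he' : Function.Injective e) (G : X → ℝ) (hG : Continuous G) (η : ℝ) (hη : 0 < η) :
    ∃ S : Finset α, ∃ δ > 0, ∀ x y, η ≤ |G x - G y| →
      δ ≤ ∑ s ∈ S, ∑ j, |e x s j - e y s j| := by
  have hev : ∀ s, Continuous fun x => e x s := fun s =>
    (continuous_eval_const s).comp he
  have hcoord : ∀ s j, Continuous fun p : X × X => |e p.1 s j - e p.2 s j| := fun s j =>
    ((((continuous_apply j).comp (hev s)).comp continuous_fst).sub
      (((continuous_apply j).comp (hev s)).comp continuous_snd)).abs
  set C : Set (X × X) := {p | η ≤ |G p.1 - G p.2|} with hCdef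
  have hC : IsCompact C := (isClosed_le continuous_const
    ((hG.comp continuous_fst).sub (hG.comp continuous_snd)).abs).isCompact
  obtain ⟨S, hS⟩ := hC.elim_finite_subcover (fun s => {p : X × X | e p.1 s ≠ e p.2 s})
    (fun s => isOpen_ne_fun ((hev s).comp continuous_fst) ((hev s).comp continuous_snd)) (by
      intro p hp
      by_contra hcon
      simp only [ne_eq, Set.mem_iUnion, Set.mem_ofPred_eq, not_exists, not_not] at hcon
      have heq : p.1 = p.2 := he' (ContinuousMap.ext hcon)
      simp only [hCdef, Set.mem_ofPred_eq, heq, sub_self, abs_zero] at hp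
      linarith)
  have hcont : Continuous fun p : X × X => ∑ s ∈ S, ∑ j, |e p.1 s j - e p.2 s j| :=
    continuous_finsetSum _ fun s _ => continuous_finsetSum _ fun j _ => hcoord s j
  have hpos : ∀ p ∈ C, 0 < ∑ s ∈ S, ∑ j, |e p.1 s j - e p.2 s j| := by
    intro p hp
    obtain ⟨s, hs, hne⟩ := Set.mem_iUnion₂.1 (hS hp)
    obtain ⟨j, hj⟩ := Function.ne_iff.1 hne
    exact Finset.sum_pos' (fun _ _ => Finset.sum_nonneg fun _ _ => abs_nonneg _)
      ⟨s, hs, Finset.sum_pos' (fun _ _ => abs_nonneg _)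
        ⟨j, Finset.mem_univ j, abs_pos.2 (sub_ne_zero.2 hj)⟩⟩
  obtain ⟨δ, hδ, hle⟩ := hC.exists_forall_le' hcont.continuousOn hpos
  exact ⟨S, δ, hδ, fun x y hxy => hle (x, y) hxy⟩

/-- Families of reals, bounded below, that are uniformly `c`-close have `c`-close infima. -/
theorem abs_ciInf_sub_ciInf_le {ι : Type*} [Nonempty ι] {g h : ι → ℝ} {c : ℝ}
    (hg : BddBelow (Set.range g)) (hh : BddBelow (Set.range h))
    (hgh : ∀ i, |g i - h i| ≤ c) : |(⨅ i, g i) - ⨅ i, h i| ≤ c := by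
  have h₁ : (⨅ i, g i) - c ≤ ⨅ i, h i := le_ciInf fun i => by
    have := ciInf_le hg i
    have := (abs_le.1 (hgh i)).2
    linarith
  have h₂ : (⨅ i, h i) - c ≤ ⨅ i, g i := le_ciInf fun i => by
    have := ciInf_le hh i
    have := (abs_le.1 (hgh i)).1
    linarith
  exact abs_le.2 ⟨by linarith, by linarith⟩

/-- A function that is Lipschitz for the total `ℓ¹` distance is averaged-Lipschitz. -/
theorem avgLip_of_abs_sub_le {d n : ℕ} {L : ℝ} {f : (Fin n → (Fin d → ℝ)) → ℝ}
    (hf : ∀ x y, |f x - f y| ≤ L * ∑ i, ∑ j, |x i j - y i j|) : AvgLip (n * L + 1) f := by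
  intro x y
  refine (hf x y).trans ?_
  rcases Nat.eq_zero_or_pos n with rfl | hn
  · simp
  · have hn' : (0 : ℝ) < n := Nat.cast_pos.2 hn
    refine mul_le_mul_of_nonneg_right ?_
      (Finset.sum_nonneg fun _ _ => Finset.sum_nonneg fun _ _ => abs_nonneg _)
    rw [le_div_iff₀ hn']
    linarith

/-- **Density of regularized cylinder functionals.** On a compact subset `K` of path space
`C([0,T]; ℝ^d)`, every continuous functional is uniformly approximated by cylinder
functionals `ω ↦ f (ω t₁, …, ω tₙ)` with `f` averaged-Lipschitz. -/
theorem cylinder_functionals_dense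
    (T : ℝ) (hT : 0 < T) (d : ℕ)
    (K : Set C(Set.Icc (0:ℝ) T, Fin d → ℝ)) (hK : IsCompact K)
    (F : C(Set.Icc (0:ℝ) T, Fin d → ℝ) → ℝ) (hF : ContinuousOn F K)
    (ε : ℝ) (hε : 0 < ε) :
    ∃ (n : ℕ) (t : Fin n → Set.Icc (0:ℝ) T), StrictMono t ∧
      ∃ (b : ℝ), 0 < b ∧
        ∃ f : (Fin n → (Fin d → ℝ)) → ℝ, AvgLip b f ∧
          ∀ ω ∈ K, |F ω - f (fun i => ω (t i))| < ε := by
  have : CompactSpace K := isCompact_iff_compactSpace.1 hK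
  rcases K.eq_empty_or_nonempty with rfl | hne
  · exact ⟨0, Fin.elim0, fun i => i.elim0, 1, one_pos, 0, fun x y => by simp, by simp⟩
  have : Nonempty K := hne.to_subtype
  have hG : Continuous fun ω : K => F ω := continuousOn_iff_continuous_domRestrict.1 hF
  obtain ⟨S, δ, hδ, hS⟩ := exists_finset_separating (fun ω : K => ω.1) continuous_subtype_val
    Subtype.val_injective (fun ω : K => F ω) hG (ε / 2) (half_pos hε)
  obtain ⟨M, hM⟩ := hK.exists_bound_of_continuousOn hF
  simp only [Real.norm_eq_abs] at hM
  have hM0 : 0 ≤ M := (abs_nonneg _).trans (hM _ hne.some_mem)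
  let t : Fin S.card → Set.Icc (0:ℝ) T := S.orderEmbOfFin rfl
  have hsum : ∀ g : Set.Icc (0:ℝ) T → ℝ, ∑ s ∈ S, g s = ∑ i, g (t i) := by
    intro g
    calc ∑ s ∈ S, g s = ∑ s ∈ Finset.univ.map (S.orderEmbOfFin rfl).toEmbedding, g s := by
          rw [Finset.map_orderEmbOfFin_univ]
      _ = ∑ i, g (t i) := Finset.sum_map _ _ _
  set L : ℝ := 2 * M / δ with hLdef
  have hL : 0 ≤ L := by positivity
  let D : (Fin S.card → (Fin d → ℝ)) → (Fin S.card → (Fin d → ℝ)) → ℝ :=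
    fun x y => ∑ i, ∑ j, |x i j - y i j|
  have hD0 : ∀ x y, 0 ≤ D x y := fun _ _ =>
    Finset.sum_nonneg fun _ _ => Finset.sum_nonneg fun _ _ => abs_nonneg _
  have hDtri : ∀ x y z, |D x z - D y z| ≤ D x y := by
    intro x y z
    simp only [D, ← Finset.sum_sub_distrib]
    refine (Finset.abs_sum_le_sum_abs _ _).trans (Finset.sum_le_sum fun i _ => ?_)
    refine (Finset.abs_sum_le_sum_abs _ _).trans (Finset.sum_le_sum fun j _ => ?_)
    simpa using abs_abs_sub_abs_le (x i j - z i j) (y i j - z i j)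
  let f : (Fin S.card → (Fin d → ℝ)) → ℝ :=
    fun x => ⨅ ω : K, (F ω + L * D x fun i => ω.1 (t i))
  have hbdd : ∀ x, BddBelow (Set.range fun ω : K => F ω + L * D x fun i => ω.1 (t i)) := by
    refine fun x => ⟨-M, ?_⟩
    rintro _ ⟨ω, rfl⟩
    have h₁ := (abs_le.1 (hM ω ω.2)).1
    have h₂ := mul_nonneg hL (hD0 x fun i => ω.1 (t i))
    dsimp only
    linarith
  refine ⟨S.card, t, (S.orderEmbOfFin rfl).strictMono, S.card * L + 1, by positivity, f,
    avgLip_of_abs_sub_le fun x y => abs_ciInf_sub_ciInf_le (hbdd x) (hbdd y) fun ω => ?_, ?_⟩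
  · rw [add_sub_add_left_eq_sub, ← mul_sub, abs_mul, abs_of_nonneg hL]
    exact mul_le_mul_of_nonneg_left (hDtri x y _) hL
  intro ω hω
  have hupper : f (fun i => ω (t i)) ≤ F ω := by
    simpa [D] using ciInf_le (hbdd fun i => ω (t i)) ⟨ω, hω⟩
  have hlower : F ω - ε / 2 ≤ f (fun i => ω (t i)) := by
    refine le_ciInf fun ω' => ?_
    rcases le_or_gt (ε / 2) |F ω - F ω'| with hfar | hnear
    · have hδD : δ ≤ D (fun i => ω (t i)) fun i => ω'.1 (t i) := by
        have := hS ⟨ω, hω⟩ ω' hfar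
        rwa [hsum] at this
      have h₁ : 2 * M ≤ L * D (fun i => ω (t i)) fun i => ω'.1 (t i) := by
        calc 2 * M = L * δ := by rw [hLdef, div_mul_cancel₀ _ hδ.ne']
          _ ≤ _ := mul_le_mul_of_nonneg_left hδD hL
      have h₂ := (abs_le.1 (hM ω hω)).2
      have h₃ := (abs_le.1 (hM ω' ω'.2)).1
      linarith
    · have h₁ := mul_nonneg hL (hD0 (fun i => ω (t i)) fun i => ω'.1 (t i))
      have h₂ := (abs_lt.1 hnear).2
      linarith
  exact abs_lt.2 ⟨by linarith, by linarith⟩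
end

section
/- Let m > 1 and γ be real numbers with 0 < γ < m − 1. Then there exists a constant C = C(m,γ) > 0, depending only on m and γ, such that for every real T > 0 and every integer k ≥ 1, defining the partition points tᵢ := T(1 − (1 − i/k)^γ) for 0 ≤ i ≤ k and increments sᵢ := tᵢ − t_{i−1} for 1 ≤ i ≤ k, one has s_k^{1/2} + Σ_{i=1}^{k−1} sᵢ^{(m+1)/2} / (T − tᵢ)^{m/2} ≤ C · T^{1/2} · k^{−γ/2}. -/
/-- A discrete mean value bound for real powers. -/
theorem rpow_add_one_sub_rpow_le {γ x : ℝ} (hγ : 0 < γ) (hx : 1 ≤ x) :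
    (x + 1) ^ γ - x ^ γ ≤ γ * Real.exp γ * x ^ (γ - 1) := by
  have hx0 : 0 < x := by linarith
  have hexp : (1 + 1 / x) ^ γ ≤ Real.exp (γ / x) := by
    calc (1 + 1 / x) ^ γ ≤ Real.exp (1 / x) ^ γ := by
          gcongr
          linarith [Real.add_one_le_exp (1 / x)]
      _ = Real.exp (γ / x) := by rw [← Real.exp_mul]; congr 1; ring
  have hlin : Real.exp (γ / x) - 1 ≤ γ / x * Real.exp (γ / x) := by
    have h := mul_le_mul_of_nonneg_right (Real.add_one_le_exp (-(γ / x)))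
      (Real.exp_pos (γ / x)).le
    rw [← Real.exp_add, neg_add_cancel, Real.exp_zero] at h
    linarith
  have hmono : γ / x * Real.exp (γ / x) ≤ γ / x * Real.exp γ := by
    gcongr
    exact div_le_self hγ.le hx
  have hsplit : (x + 1) ^ γ = x ^ γ * (1 + 1 / x) ^ γ := by
    rw [← Real.mul_rpow hx0.le (by positivity)]
    congr 1
    field_simp
  calc (x + 1) ^ γ - x ^ γ = x ^ γ * ((1 + 1 / x) ^ γ - 1) := by rw [hsplit]; ring
    _ ≤ x ^ γ * (γ / x * Real.exp γ) := by gcongr; linarith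
    _ = γ * Real.exp γ * x ^ (γ - 1) := by rw [Real.rpow_sub_one hx0.ne']; ring

theorem rpow_increment_div_rpow_le {m γ P x : ℝ} (hm : 1 < m) (hγ : 0 < γ) (hP : 0 < P)
    (hx : 1 ≤ x) :
    (P * ((x + 1) ^ γ - x ^ γ)) ^ ((m + 1) / 2) / (P * x ^ γ) ^ (m / 2) ≤
      P ^ ((1 : ℝ) / 2) * ((γ * Real.exp γ) ^ ((m + 1) / 2) * x ^ ((γ - m - 1) / 2)) := by
  have hx0 : 0 < x := by linarith
  have hd : 0 ≤ (x + 1) ^ γ - x ^ γ :=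
    sub_nonneg.2 (Real.rpow_le_rpow hx0.le (by linarith) hγ.le)
  have hA : 0 < γ * Real.exp γ := by positivity
  calc (P * ((x + 1) ^ γ - x ^ γ)) ^ ((m + 1) / 2) / (P * x ^ γ) ^ (m / 2)
      ≤ (P * (γ * Real.exp γ * x ^ (γ - 1))) ^ ((m + 1) / 2) / (P * x ^ γ) ^ (m / 2) := by
        gcongr
        exact rpow_add_one_sub_rpow_le hγ hx
    _ = P ^ ((1 : ℝ) / 2) * ((γ * Real.exp γ) ^ ((m + 1) / 2) * x ^ ((γ - m - 1) / 2)) := by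
        rw [div_eq_iff (by positivity), Real.mul_rpow hP.le (by positivity),
          Real.mul_rpow hA.le (by positivity), Real.mul_rpow hP.le (by positivity),
          ← Real.rpow_mul hx0.le, ← Real.rpow_mul hx0.le,
          show (m + 1) / 2 = 1 / 2 + m / 2 by ring, Real.rpow_add hP,
          show (γ - 1) * (1 / 2 + m / 2) = (γ - m - 1) / 2 + γ * (m / 2) by ring,
          Real.rpow_add hx0]
        ring

theorem sum_Icc_one_pred_reflect (g : ℕ → ℝ) (k : ℕ) :
    ∑ i ∈ Finset.Icc 1 (k - 1), g (k - i) = ∑ j ∈ Finset.Icc 1 (k - 1), g j := by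
  refine Finset.sum_nbij' (fun i => k - i) (fun i => k - i) ?_ ?_ ?_ ?_ ?_ <;>
    intro i hi <;> simp only [Finset.mem_Icc] at hi ⊢ <;> omega

/-- Summation bound for the non-uniform partition `tᵢ = T(1 − (1 − i/k)^γ)`:
there is a constant `C = C(m,γ) > 0` such that for all `T > 0` and all `k ≥ 1`,
`s_k^{1/2} + ∑_{i=1}^{k−1} sᵢ^{(m+1)/2}/(T − tᵢ)^{m/2} ≤ C T^{1/2} k^{−γ/2}`,
where `sᵢ = tᵢ − t_{i−1}`. -/
theorem partition_sum_bound
    (m γ : ℝ) (hm : 1 < m) (hγ : 0 < γ) (hγm : γ < m - 1) :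
    ∃ C : ℝ, 0 < C ∧
      ∀ T : ℝ, 0 < T → ∀ k : ℕ, 1 ≤ k →
        let t : ℕ → ℝ := fun i => T * (1 - (1 - (i:ℝ)/(k:ℝ)) ^ γ)
        let s : ℕ → ℝ := fun i => t i - t (i - 1)
        s k ^ ((1:ℝ)/2) +
            ∑ i ∈ Finset.Icc 1 (k-1), s i ^ ((m+1)/2) / (T - t i) ^ (m/2)
          ≤ C * T ^ ((1:ℝ)/2) * (k:ℝ) ^ (-γ/2) := by
  set A : ℝ := (γ * Real.exp γ) ^ ((m + 1) / 2)
  have hA : 0 < A := by positivity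
  have hsum : Summable fun j : ℕ => (j : ℝ) ^ ((γ - m - 1) / 2) :=
    Real.summable_nat_rpow.2 (by linarith)
  set S : ℝ := ∑' j : ℕ, (j : ℝ) ^ ((γ - m - 1) / 2)
  have hS : 0 ≤ S := tsum_nonneg fun j => by positivity
  refine ⟨1 + A * S, by positivity, ?_⟩
  intro T hT k hk t s
  have hk0 : (0 : ℝ) < k := by exact_mod_cast hk
  set P : ℝ := T * (k : ℝ) ^ (-γ) with hPdef
  have hP : 0 < P := by positivity
  have hPhalf : P ^ ((1 : ℝ) / 2) = T ^ ((1 : ℝ) / 2) * (k : ℝ) ^ (-γ / 2) := by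
    rw [hPdef, Real.mul_rpow hT.le (by positivity), ← Real.rpow_mul hk0.le]
    congr 2
    ring
  have ht : ∀ i ≤ k, T - t i = P * ((k - i : ℕ) : ℝ) ^ γ := by
    intro i hi
    have hbase : 1 - (i : ℝ) / k = ((k - i : ℕ) : ℝ) / k := by
      rw [Nat.cast_sub hi]
      field_simp
    simp only [t]
    rw [hbase, Real.div_rpow (by positivity) hk0.le, hPdef, Real.rpow_neg hk0.le]
    ring
  have hs : ∀ i, 1 ≤ i → i ≤ k →
      s i = P * ((((k - i : ℕ) : ℝ) + 1) ^ γ - ((k - i : ℕ) : ℝ) ^ γ) := by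
    intro i h1 hi
    have h2 := ht (i - 1) (by omega)
    rw [show k - (i - 1) = (k - i) + 1 by omega, Nat.cast_add_one] at h2
    simp only [s]
    linarith [ht i hi]
  have hlast : s k = P := by
    rw [hs k hk le_rfl]
    simp [Real.zero_rpow hγ.ne']
  have hterms : ∑ i ∈ Finset.Icc 1 (k - 1), s i ^ ((m + 1) / 2) / (T - t i) ^ (m / 2) ≤
      P ^ ((1 : ℝ) / 2) * (A * S) :=
    calc ∑ i ∈ Finset.Icc 1 (k - 1), s i ^ ((m + 1) / 2) / (T - t i) ^ (m / 2)
        ≤ ∑ i ∈ Finset.Icc 1 (k - 1),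
            P ^ ((1 : ℝ) / 2) * (A * ((k - i : ℕ) : ℝ) ^ ((γ - m - 1) / 2)) := by
          refine Finset.sum_le_sum fun i hi => ?_
          rw [Finset.mem_Icc] at hi
          rw [hs i hi.1 (by omega), ht i (by omega)]
          exact rpow_increment_div_rpow_le hm hγ hP
            (by exact_mod_cast (show 1 ≤ k - i by omega))
      _ = P ^ ((1 : ℝ) / 2) *
            (A * ∑ j ∈ Finset.Icc 1 (k - 1), (j : ℝ) ^ ((γ - m - 1) / 2)) := by
          rw [← Finset.mul_sum, ← Finset.mul_sum,
            sum_Icc_one_pred_reflect (fun j => (j : ℝ) ^ ((γ - m - 1) / 2))]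
      _ ≤ P ^ ((1 : ℝ) / 2) * (A * S) := by
          gcongr
          exact hsum.sum_le_tsum _ fun j _ => by positivity
  rw [hlast, mul_assoc, ← hPhalf]
  linarith
end

section
/- Let z₁,…,z_N ∈ ℝ^D be points with strictly positive weights λ₁,…,λ_N summing to 1, let {J₁,…,J_l} be a partition of the index set {1,…,N} into l nonempty blocks, and let p₁,…,p_r : ℝ^D → ℝ be test functions. Then there exist nonnegative weights λ̃₁,…,λ̃_N such that: for every block s ∈ {1,…,l}, Σ_{i∈J_s} λ̃ᵢ = Σ_{i∈J_s} λᵢ and Σ_{i∈J_s} λ̃ᵢ p_j(zᵢ) = Σ_{i∈J_s} λᵢ p_j(zᵢ) for every j = 1,…,r, and the number of indices i ∈ J_s with λ̃ᵢ > 0 is at most r + 1. In particular, Σᵢ λ̃ᵢ = 1, the global integrals Σᵢ λ̃ᵢ p_j(zᵢ) = Σᵢ λᵢ p_j(zᵢ) of all test functions are preserved, and the total number of indices with λ̃ᵢ > 0 is at most l(r+1). -/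
/-- **Carathéodory's theorem for cones**: a nonnegative combination of a finite family of vectors
can be rewritten as one with at most `finrank` positive coefficients. -/
theorem Finset.exists_nonneg_sum_smul_eq_card_le_finrank {𝕜 ι E : Type*} [Field 𝕜] [LinearOrder 𝕜]
    [IsStrictOrderedRing 𝕜] [AddCommGroup E] [Module 𝕜 E] [FiniteDimensional 𝕜 E]
    (s : Finset ι) (v : ι → E) (w : ι → 𝕜) (hw : ∀ i ∈ s, 0 ≤ w i) :
    ∃ w' : ι → 𝕜, (∀ i ∈ s, 0 ≤ w' i) ∧ ∑ i ∈ s, w' i • v i = ∑ i ∈ s, w i • v i ∧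
      (s.filter (fun i => 0 < w' i)).card ≤ Module.finrank 𝕜 E := by
  classical
  induction hn : (s.filter (fun i => 0 < w i)).card using Nat.strong_induction_on
    generalizing w with
  | _ n ih =>
  set t := s.filter (fun i => 0 < w i) with ht
  by_cases hle : t.card ≤ Module.finrank 𝕜 E
  · exact ⟨w, hw, rfl, hle⟩
  have hdep : ¬ LinearIndepOn 𝕜 v (t : Set ι) := fun h => hle <| by
    simpa using LinearIndependent.fintype_card_le_finrank h
  obtain ⟨g, hg, hgpos⟩ : ∃ g : ι → 𝕜, ∑ i ∈ t, g i • v i = 0 ∧ ∃ i ∈ t, 0 < g i := by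
    rw [linearIndepOn_finset_iff] at hdep
    push Not at hdep
    obtain ⟨g, hg, i, hi, hne⟩ := hdep
    rcases hne.lt_or_gt with h | h
    · exact ⟨-g, by simp [hg], i, hi, by simpa using h⟩
    · exact ⟨g, hg, i, hi, h⟩
  obtain ⟨k, hk, hkmin⟩ := (t.filter (fun i => 0 < g i)).exists_min_image (fun i => w i / g i)
    (by simpa [Finset.Nonempty] using hgpos)
  obtain ⟨hkt, hgk⟩ := Finset.mem_filter.mp hk
  obtain ⟨hks, hwk⟩ := Finset.mem_filter.mp hkt
  set c := w k / g k with hc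
  have hcpos : 0 < c := div_pos hwk hgk
  set u : ι → 𝕜 := fun i => w i - if i ∈ t then c * g i else 0 with hu
  have hu_nonneg : ∀ i ∈ s, 0 ≤ u i := by
    intro i hi
    by_cases hit : i ∈ t
    · simp only [hu, if_pos hit, sub_nonneg]
      rcases le_or_gt (g i) 0 with h | h
      · exact (mul_nonpos_of_nonneg_of_nonpos hcpos.le h).trans (hw i hi)
      · exact (le_div_iff₀ h).mp (hkmin i (Finset.mem_filter.mpr ⟨hit, h⟩))
    · simpa [hu, hit] using hw i hi
  have hu_sum : ∑ i ∈ s, u i • v i = ∑ i ∈ s, w i • v i := by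
    have h : ∑ i ∈ s, (if i ∈ t then c * g i else 0) • v i = 0 := by
      simp only [ite_smul, zero_smul, mul_smul]
      rw [← Finset.sum_filter, Finset.filter_mem_eq_inter,
        Finset.inter_eq_right.mpr (Finset.filter_subset _ _), ← Finset.smul_sum, hg, smul_zero]
    simp only [hu, sub_smul, Finset.sum_sub_distrib, h, sub_zero]
  have hu_card : (s.filter (fun i => 0 < u i)).card < n := by
    rw [← hn]
    refine Finset.card_lt_card (Finset.ssubset_iff_of_subset ?_ |>.mpr ⟨k, hkt, ?_⟩)
    · intro i hi
      by_contra hit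
      obtain ⟨his, hui⟩ := Finset.mem_filter.mp hi
      simp only [hu, if_neg hit, sub_zero] at hui
      exact hit (Finset.mem_filter.mpr ⟨his, hui⟩)
    · simp [hu, hkt, hc, div_mul_cancel₀ _ hgk.ne']
  obtain ⟨w', h₁, h₂, h₃⟩ := ih _ hu_card u hu_nonneg rfl
  exact ⟨w', h₁, h₂.trans hu_sum, h₃⟩

/-- Nonnegative weights on a finite set can be replaced by nonnegative weights with at most `r + 1`
positive values, preserving the total mass and the integrals of `r` functions. -/
theorem Finset.exists_nonneg_sum_eq_sum_mul_eq_card_le {ι : Type*} {r : ℕ} (s : Finset ι)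
    (f : Fin r → ι → ℝ) (w : ι → ℝ) (hw : ∀ i ∈ s, 0 ≤ w i) :
    ∃ w' : ι → ℝ, (∀ i ∈ s, 0 ≤ w' i) ∧ ∑ i ∈ s, w' i = ∑ i ∈ s, w i ∧
      (∀ j, ∑ i ∈ s, w' i * f j i = ∑ i ∈ s, w i * f j i) ∧
      (s.filter (fun i => 0 < w' i)).card ≤ r + 1 := by
  obtain ⟨w', h₁, h₂, h₃⟩ := s.exists_nonneg_sum_smul_eq_card_le_finrank
    (fun i => (Fin.cons 1 (fun j => f j i) : Fin (r + 1) → ℝ)) w hw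
  refine ⟨w', h₁, ?_, fun j => ?_, by simpa using h₃⟩
  · simpa using congrFun h₂ 0
  · simpa using congrFun h₂ j.succ

/-- **Localized measure reduction.** Given a discrete probability measure on points of
`ℝ^D` together with a partition (localization) of its atoms into `l` blocks and `r` test
functions, there are nonnegative weights matching, within every block, the block mass and
all block test-function integrals, with at most `r + 1` positive weights per block; in
particular the total mass is one, all global test-function integrals are preserved, and at
most `l (r + 1)` weights are positive. -/
theorem localized_measure_reduction
    (D N l r : ℕ) (z : Fin N → (Fin D → ℝ))
    (lam : Fin N → ℝ) (hpos : ∀ i, 0 < lam i) (hsum : ∑ i, lam i = 1)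
    (J : Fin l → Finset (Fin N))
    (hJne : ∀ s, (J s).Nonempty)
    (hJdisj : ∀ s t, s ≠ t → Disjoint (J s) (J t))
    (hJcover : Finset.univ.biUnion J = Finset.univ)
    (p : Fin r → (Fin D → ℝ) → ℝ) :
    ∃ lamt : Fin N → ℝ,
      (∀ i, 0 ≤ lamt i) ∧
      (∀ s, ∑ i ∈ J s, lamt i = ∑ i ∈ J s, lam i) ∧
      (∀ s, ∀ j, ∑ i ∈ J s, lamt i * p j (z i) = ∑ i ∈ J s, lam i * p j (z i)) ∧
      (∀ s, ((J s).filter (fun i => 0 < lamt i)).card ≤ r + 1) ∧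
      (∑ i, lamt i = 1) ∧
      (∀ j, ∑ i, lamt i * p j (z i) = ∑ i, lam i * p j (z i)) ∧
      (Finset.univ.filter (fun i => 0 < lamt i)).card ≤ l * (r + 1) := by
  have hex (s : Fin l) := (J s).exists_nonneg_sum_eq_sum_mul_eq_card_le
    (fun j i => p j (z i)) lam (fun i _ => (hpos i).le)
  choose w hw_nonneg hw_sum hw_int hw_card using hex
  have hblock : ∀ i, ∃ s, i ∈ J s := fun i => by
    simpa using hJcover.ge (Finset.mem_univ i)
  choose b hb using hblock
  have hb_eq : ∀ s, ∀ i ∈ J s, b i = s := fun s i hi => by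
    by_contra hne
    exact Finset.disjoint_left.mp (hJdisj _ _ hne) (hb i) hi
  have hglobal : ∀ f : Fin N → ℝ, ∑ i, f i = ∑ s, ∑ i ∈ J s, f i := fun f => by
    rw [← hJcover, Finset.sum_biUnion fun s _ t _ hst => hJdisj s t hst]
  have hmass : ∀ s, ∑ i ∈ J s, w (b i) i = ∑ i ∈ J s, lam i := fun s => by
    rw [← hw_sum s]
    exact Finset.sum_congr rfl fun i hi => by rw [hb_eq s i hi]
  have hint : ∀ s j, ∑ i ∈ J s, w (b i) i * p j (z i) = ∑ i ∈ J s, lam i * p j (z i) :=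
    fun s j => by
      rw [← hw_int s j]
      exact Finset.sum_congr rfl fun i hi => by rw [hb_eq s i hi]
  have hcard : ∀ s, ((J s).filter (fun i => 0 < w (b i) i)).card ≤ r + 1 := fun s => by
    rw [Finset.filter_congr fun i hi => by rw [hb_eq s i hi]]
    exact hw_card s
  refine ⟨fun i => w (b i) i, fun i => hw_nonneg _ i (hb i), hmass, hint, hcard, ?_, fun j => ?_, ?_⟩
  · rw [← hsum, hglobal, hglobal lam]
    exact Finset.sum_congr rfl fun s _ => hmass s
  · rw [hglobal, hglobal fun i => lam i * p j (z i)]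
    exact Finset.sum_congr rfl fun s _ => hint s j
  · rw [← hJcover, Finset.filter_biUnion]
    simpa using Finset.card_biUnion_le_card_mul Finset.univ _ (r + 1) fun s _ => hcard s
end

section
/- Let T > 0, d ∈ ℕ, let K ⊆ C([0,T]; ℝ^d) be compact in the uniform topology, and let Q and Q̂ be Borel probability measures on C([0,T]; ℝ^d) with Q(K) = Q̂(K) = 1. Then for every continuous functional F : C([0,T]; ℝ^d) → ℝ and every ε > 0, there exist n ∈ ℕ, times 0 ≤ t₁ < … < tₙ ≤ T, a constant b > 0, and a function f : (ℝ^d)ⁿ → ℝ satisfying the n-averaged Lipschitz condition with constant b, such that, setting Fₙ(ω) := f(ω(t₁),…,ω(tₙ)), one has |∫ F dQ − ∫ F dQ̂| ≤ |∫ Fₙ dQ − ∫ Fₙ dQ̂| + ε. That is, the discrepancy between two compactly supported path-space measures against any continuous functional is approximated, within ε, by their discrepancy against a regularized cylinder functional. -/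
open MeasureTheory

/-- Borel σ-algebra on path space `C([0,T]; ℝ^d)`. -/
noncomputable instance pathSpaceMeasurableSpace (T : ℝ) (d : ℕ) :
    MeasurableSpace C(Set.Icc (0:ℝ) T, Fin d → ℝ) := borel _

instance pathSpace_borelSpace (T : ℝ) (d : ℕ) :
    BorelSpace C(Set.Icc (0:ℝ) T, Fin d → ℝ) := ⟨rfl⟩

/-- `g` is Lipschitz, with constant `C`, in the `ℓ¹` norm of the coordinates in `S`. -/
def LipOnCoords {ι : Type*} {d : ℕ} (S : Finset ι) (C : ℝ) (g : (ι → Fin d → ℝ) → ℝ) : Prop :=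
  ∀ x y, |g x - g y| ≤ C * ∑ s ∈ S, ∑ j, |x s j - y s j|

namespace LipOnCoords

variable {ι : Type*} {d : ℕ} {S S' : Finset ι} {C C' : ℝ} {g g' : (ι → Fin d → ℝ) → ℝ}

theorem mono (h : LipOnCoords S C g) (hC : 0 ≤ C) (hS : S ⊆ S') (hCC' : C ≤ C') :
    LipOnCoords S' C' g := by
  intro x y
  refine (h x y).trans (mul_le_mul hCC' ?_ (by positivity) (hC.trans hCC'))
  exact Finset.sum_le_sum_of_subset_of_nonneg hS fun _ _ _ => by positivity

theorem sup (h : LipOnCoords S C g) (h' : LipOnCoords S C g') :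
    LipOnCoords S C (fun x => g x ⊔ g' x) := fun x y =>
  (abs_max_sub_max_le_max _ _ _ _).trans (max_le (h x y) (h' x y))

theorem inf (h : LipOnCoords S C g) (h' : LipOnCoords S C g') :
    LipOnCoords S C (fun x => g x ⊓ g' x) := fun x y =>
  (abs_min_sub_min_le_max _ _ _ _).trans (max_le (h x y) (h' x y))

theorem affine (s : ι) (j : Fin d) (a c : ℝ) :
    LipOnCoords {s} |a| (fun x : ι → Fin d → ℝ => a * x s j + c) := by
  intro x y
  rw [Finset.sum_singleton, add_sub_add_right_eq_sub, ← mul_sub, abs_mul]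
  exact mul_le_mul_of_nonneg_left
    (Finset.single_le_sum (f := fun j => |x s j - y s j|) (fun _ _ => abs_nonneg _)
      (Finset.mem_univ j)) (abs_nonneg a)

/-- A function Lipschitz in finitely many coordinates is a cylinder function with
averaged-Lipschitz base. -/
theorem exists_avgLip [LinearOrder ι] (h : LipOnCoords S C g) (hC : 0 ≤ C) :
    ∃ (n : ℕ) (t : Fin n → ι), StrictMono t ∧ ∃ b : ℝ, 0 < b ∧
      ∃ f : (Fin n → (Fin d → ℝ)) → ℝ, AvgLip b f ∧ ∀ x, f (fun i => x (t i)) = g x := by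
  let e := S.orderIsoOfFin rfl
  let E : (Fin S.card → (Fin d → ℝ)) → ι → Fin d → ℝ :=
    fun x s => if hs : s ∈ S then x (e.symm ⟨s, hs⟩) else 0
  have hE : ∀ x i, E x (e i) = x i := fun x i => by simp [E]
  have hsum : ∀ u : ι → ℝ, ∑ s ∈ S, u s = ∑ i, u (e i) := fun u => by
    rw [← Finset.sum_coe_sort S]
    exact (e.toEquiv.sum_comp fun s : S => u s).symm
  refine ⟨S.card, fun i => e i, fun i j hij => e.strictMono hij, S.card * C + 1, by positivity,
    fun x => g (E x), fun x y => ?_, fun x => ?_⟩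
  · refine (h _ _).trans ?_
    rw [hsum]
    simp only [hE]
    rcases Nat.eq_zero_or_pos S.card with h0 | hpos
    · have : IsEmpty (Fin S.card) := by rw [h0]; infer_instance
      simp
    · have hpos' : (0:ℝ) < S.card := by exact_mod_cast hpos
      refine mul_le_mul_of_nonneg_right ?_ (by positivity)
      rw [le_div_iff₀ hpos']
      linarith
  · have hle := h (E fun i => x (e i)) x
    rw [hsum] at hle
    simp only [hE, sub_self, abs_zero, Finset.sum_const_zero, mul_zero] at hle
    exact sub_eq_zero.1 (abs_nonpos_iff.1 hle)

end LipOnCoords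

/-- On a compact set of paths, Lipschitz cylinder functionals are uniformly dense in the
continuous functionals. -/
theorem exists_lipOnCoords_near {X : Type*} [TopologicalSpace X] {d : ℕ}
    {K : Set C(X, Fin d → ℝ)} (hK : IsCompact K) {F : C(X, Fin d → ℝ) → ℝ}
    (hF : ContinuousOn F K) {ε : ℝ} (hε : 0 < ε) :
    ∃ (S : Finset X) (C : ℝ) (g : (X → Fin d → ℝ) → ℝ), 0 ≤ C ∧ LipOnCoords S C g ∧
      ∀ ω ∈ K, |F ω - g ω| < ε := by
  classical
  have : CompactSpace K := isCompact_iff_compactSpace.1 hK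
  let L : Set C(K, ℝ) := {G | ∃ (S : Finset X) (C : ℝ) (g : (X → Fin d → ℝ) → ℝ),
    0 ≤ C ∧ LipOnCoords S C g ∧ ∀ ω : K, G ω = g ω.1}
  have common : ∀ G ∈ L, ∀ G' ∈ L, ∃ (S : Finset X) (C : ℝ) (g g' : (X → Fin d → ℝ) → ℝ),
      0 ≤ C ∧ LipOnCoords S C g ∧ LipOnCoords S C g' ∧
        (∀ ω : K, G ω = g ω.1) ∧ ∀ ω : K, G' ω = g' ω.1 := by
    rintro G ⟨S, C, g, hC, hg, hG⟩ G' ⟨S', C', g', hC', hg', hG'⟩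
    exact ⟨S ∪ S', max C C', g, g', le_max_of_le_left hC,
      hg.mono hC Finset.subset_union_left (le_max_left _ _),
      hg'.mono hC' Finset.subset_union_right (le_max_right _ _), hG, hG'⟩
  have const_mem : ∀ c : ℝ, ContinuousMap.const K c ∈ L := fun c =>
    ⟨∅, 0, fun _ => c, le_rfl, fun x y => by simp, fun _ => rfl⟩
  have hdense : closure L = ⊤ := by
    refine ContinuousMap.sublattice_closure_eq_top L ⟨_, const_mem 0⟩ ?_ ?_ ?_
    · intro G hG G' hG'
      obtain ⟨S, C, g, g', hC, hg, hg', h, h'⟩ := common G hG G' hG'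
      exact ⟨S, C, _, hC, hg.inf hg', fun ω => by simp [h, h']⟩
    · intro G hG G' hG'
      obtain ⟨S, C, g, g', hC, hg, hg', h, h'⟩ := common G hG G' hG'
      exact ⟨S, C, _, hC, hg.sup hg', fun ω => by simp [h, h']⟩
    · intro v ω η
      by_cases hne : ω = η
      · exact ⟨_, const_mem (v ω), rfl, by simp [hne]⟩
      obtain ⟨s, j, hsj⟩ : ∃ s j, ω.1 s j ≠ η.1 s j := by
        by_contra! hall
        exact hne (Subtype.ext (ContinuousMap.ext fun s => funext (hall s)))
      have hsub : η.1 s j - ω.1 s j ≠ 0 := sub_ne_zero.2 hsj.symm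
      let a := (v η - v ω) / (η.1 s j - ω.1 s j)
      refine ⟨⟨fun ξ => a * ξ.1 s j + (v ω - a * ω.1 s j), ?_⟩,
        ⟨{s}, |a|, _, abs_nonneg a, LipOnCoords.affine s j a (v ω - a * ω.1 s j),
          fun _ => rfl⟩, ?_, ?_⟩
      · have : Continuous fun ξ : K => ξ.1 s :=
          (continuous_eval_const s).comp continuous_subtype_val
        fun_prop
      · simp
      · simp only [ContinuousMap.coe_mk, a]
        field_simp
        ring
  let FK : C(K, ℝ) := ⟨K.domRestrict F, hF.domRestrict⟩
  have hmem : FK ∈ closure L := by rw [hdense]; trivial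
  obtain ⟨G, ⟨S, C, g, hC, hg, hG⟩, hdist⟩ := Metric.mem_closure_iff.1 hmem ε hε
  refine ⟨S, C, g, hC, hg, fun ω hω => ?_⟩
  rw [← hG ⟨ω, hω⟩]
  exact (ContinuousMap.dist_apply_le_dist (f := FK) (g := G) ⟨ω, hω⟩).trans_lt hdist

theorem AvgLip.continuous {d n : ℕ} {b : ℝ} {f : (Fin n → (Fin d → ℝ)) → ℝ} (hf : AvgLip b f) :
    Continuous f := by
  rw [continuous_iff_continuousAt]
  intro y
  refine tendsto_iff_dist_tendsto_zero.2
    (squeeze_zero (fun _ => dist_nonneg) (fun x => hf x y) ?_)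
  have : Continuous fun x : Fin n → (Fin d → ℝ) => (b / n) * ∑ i, ∑ j, |x i j - y i j| := by
    fun_prop
  simpa using this.tendsto y

/-- Continuous functions that are uniformly close on a compact carrier of a probability measure
have close integrals. -/
theorem abs_integral_sub_integral_le_of_compact {E : Type*} [TopologicalSpace E] [T2Space E]
    [MeasurableSpace E] [BorelSpace E] {μ : Measure E} [IsProbabilityMeasure μ] {K : Set E}
    (hK : IsCompact K) (hμK : μ K = 1) {F G : E → ℝ} (hF : Continuous F) (hG : Continuous G)
    {δ : ℝ} (hFG : ∀ x ∈ K, |F x - G x| ≤ δ) :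
    |(∫ x, F x ∂μ) - ∫ x, G x ∂μ| ≤ δ := by
  have hae : ∀ᵐ x ∂μ, x ∈ K := (prob_compl_eq_zero_iff hK.measurableSet).2 hμK
  have hint : ∀ H : E → ℝ, Continuous H → Integrable H μ := fun H hH => by
    obtain ⟨c, hc⟩ := hK.exists_bound_of_continuousOn hH.continuousOn
    exact Integrable.of_bound hH.aestronglyMeasurable c (hae.mono hc)
  rw [← integral_sub (hint F hF) (hint G hG)]
  simpa using norm_integral_le_of_norm_le_const (f := fun x => F x - G x) (hae.mono hFG)

/-- The discrepancy of two compactly supported Borel probability measures on path space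
against any continuous functional is approximated, within `ε`, by their discrepancy
against a regularized (averaged-Lipschitz) cylinder functional. -/
theorem cylinder_discrepancy_approx
    (T : ℝ) (hT : 0 < T) (d : ℕ)
    (K : Set C(Set.Icc (0:ℝ) T, Fin d → ℝ)) (hK : IsCompact K)
    (Q Qhat : Measure C(Set.Icc (0:ℝ) T, Fin d → ℝ))
    [IsProbabilityMeasure Q] [IsProbabilityMeasure Qhat]
    (hQK : Q K = 1) (hQhatK : Qhat K = 1)
    (F : C(Set.Icc (0:ℝ) T, Fin d → ℝ) → ℝ) (hF : Continuous F)
    (ε : ℝ) (hε : 0 < ε) :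
    ∃ (n : ℕ) (t : Fin n → Set.Icc (0:ℝ) T), StrictMono t ∧
      ∃ (b : ℝ), 0 < b ∧
        ∃ f : (Fin n → (Fin d → ℝ)) → ℝ, AvgLip b f ∧
          |(∫ ω, F ω ∂Q) - ∫ ω, F ω ∂Qhat| ≤
            |(∫ ω, f (fun i => ω (t i)) ∂Q) - ∫ ω, f (fun i => ω (t i)) ∂Qhat| + ε := by
  obtain ⟨S, C, g, hC, hg, hFg⟩ := exists_lipOnCoords_near hK hF.continuousOn (half_pos hε)
  obtain ⟨n, t, ht, b, hb, f, hf, hfg⟩ := hg.exists_avgLip hC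
  refine ⟨n, t, ht, b, hb, f, hf, ?_⟩
  have hcont : Continuous fun ω : C(Set.Icc (0:ℝ) T, Fin d → ℝ) => f (fun i => ω (t i)) :=
    hf.continuous.comp (continuous_pi fun i => continuous_eval_const (t i))
  have hclose : ∀ ω ∈ K, |F ω - f (fun i => ω (t i))| ≤ ε / 2 := fun ω hω => by
    rw [hfg ω]
    exact (hFg ω hω).le
  have h₁ := abs_integral_sub_integral_le_of_compact hK hQK hF hcont hclose
  have h₂ := abs_integral_sub_integral_le_of_compact hK hQhatK hF hcont hclose
  rw [abs_le] at h₁ h₂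
  refine abs_le.2 ⟨?_, ?_⟩
  · linarith [neg_abs_le ((∫ ω, f (fun i => ω (t i)) ∂Q) - ∫ ω, f (fun i => ω (t i)) ∂Qhat)]
  · linarith [le_abs_self ((∫ ω, f (fun i => ω (t i)) ∂Q) - ∫ ω, f (fun i => ω (t i)) ∂Qhat)]
end
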